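/- arXiv:1807.00104 — 4 statements merged into one kernel-verified Lean document; each statement's English description precedes it below -/
import Mathlib

section
/- If M and N are p-controlled abelian groups, then: (i) every extension of N by M (i.e., every abelian group P fitting in a short exact sequence 0 → M → P → N → 0) is p-controlled; and (ii) for every group homomorphism f: M → N, both ker f and coker f are p-controlled. -/
/-- An abelian group `M` is *`p`-controlled* if it is the direct sum of a uniquely divisible
subgroup and a subgroup annihilated by some power of `p`. -/
def IsPControlled (p : ℕ) (M : Type) [AddCommGroup M] : Prop :=
  ∃ Mdiv Mtor : AddSubgroup M,
    IsCompl Mdiv Mtor ∧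
    (∀ n : ℕ, 0 < n → Function.Bijective fun x : Mdiv => n • x) ∧
    ∃ k : ℕ, ∀ x ∈ Mtor, (p ^ k) • x = 0

/-- An abelian group is `p`-controlled if and only if some power of `p` annihilates its torsion
and maps the group into its divisible elements. -/
theorem isPControlled_iff {p : ℕ} (hp : 0 < p) {M : Type} [AddCommGroup M] :
    IsPControlled p M ↔ ∃ k : ℕ,
      (∀ n : ℕ, 0 < n → ∀ x : M, n • x = 0 → p ^ k • x = 0) ∧
      (∀ n : ℕ, 0 < n → ∀ x : M, ∃ y : M, n • y = p ^ k • x) := by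
  constructor
  · rintro ⟨D, T, hDT, hD, k, hT⟩
    have hdecomp (x : M) : ∃ d ∈ D, ∃ t ∈ T, d + t = x :=
      AddSubgroup.mem_sup.1 (hDT.sup_eq_top ▸ AddSubgroup.mem_top x)
    refine ⟨k, fun n hn x hx => ?_, fun n hn x => ?_⟩
    · obtain ⟨d, hd, t, ht, rfl⟩ := hdecomp x
      have hnd : n • d = 0 := by
        refine AddSubgroup.disjoint_def.1 hDT.disjoint (nsmul_mem hd n) ?_
        rw [smul_add] at hx
        rw [eq_neg_of_add_eq_zero_left hx]
        exact neg_mem (nsmul_mem ht n)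
      have hd0 : (⟨d, hd⟩ : D) = 0 := (hD n hn).1 (by ext; simpa using hnd)
      obtain rfl : d = 0 := congrArg Subtype.val hd0
      simpa using hT t ht
    · obtain ⟨d, hd, t, ht, rfl⟩ := hdecomp x
      obtain ⟨y, hy⟩ := (hD n hn).2 (p ^ k • ⟨d, hd⟩)
      refine ⟨y, ?_⟩
      rw [smul_add, hT t ht, add_zero]
      simpa using congrArg Subtype.val hy
  · rintro ⟨k, htors, hdiv⟩
    have hpk : 0 < p ^ k := pow_pos hp k
    have hdisj (x : M) (n : ℕ) (hn : 0 < n) (hx : n • p ^ k • x = 0) : p ^ k • x = 0 :=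
      htors (n * p ^ k) (Nat.mul_pos hn hpk) x (by rw [mul_smul, hx])
    refine ⟨(nsmulAddMonoidHom (α := M) (p ^ k)).range, (nsmulAddMonoidHom (α := M) (p ^ k)).ker,
      ⟨?_, ?_⟩, fun n hn => ⟨?_, ?_⟩, k, fun x hx => hx⟩
    · rw [AddSubgroup.disjoint_def]
      rintro _ ⟨x, rfl⟩ hx
      exact hdisj x (p ^ k) hpk hx
    · rw [codisjoint_iff, eq_top_iff]
      intro x _
      obtain ⟨y, hy⟩ := hdiv (p ^ k * p ^ k) (Nat.mul_pos hpk hpk) x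
      refine AddSubgroup.mem_sup.2 ⟨p ^ k • y, ⟨y, rfl⟩, x - p ^ k • y, ?_, by abel⟩
      change p ^ k • (x - p ^ k • y) = 0
      rw [smul_sub, ← mul_smul, hy, sub_self]
    · rintro ⟨_, x, rfl⟩ ⟨_, y, rfl⟩ hxy
      have hxy' : n • p ^ k • x = n • p ^ k • y := congrArg Subtype.val hxy
      have := hdisj (x - y) n hn (by rw [smul_sub, smul_sub, hxy', sub_self])
      exact Subtype.ext (sub_eq_zero.1 (by rwa [smul_sub] at this))
    · rintro ⟨_, x, rfl⟩
      obtain ⟨y, hy⟩ := hdiv (n * p ^ k) (Nat.mul_pos hn hpk) x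
      exact ⟨⟨p ^ k • y, y, rfl⟩, Subtype.ext (by rw [mul_smul] at hy; exact hy)⟩

/-- If `M` and `N` are `p`-controlled abelian groups, then (i) every
extension of `N` by `M` is `p`-controlled, and (ii) for every homomorphism `f : M → N`
both the kernel and the cokernel of `f` are `p`-controlled. -/
theorem isPControlled_extension_and_ker_coker
    (p : ℕ) [Fact p.Prime]
    (M N : Type) [AddCommGroup M] [AddCommGroup N]
    (hM : IsPControlled p M) (hN : IsPControlled p N) :
    (∀ (P : Type) [AddCommGroup P] (f : M →+ P) (g : P →+ N),
      Function.Injective f → Function.Surjective g → Function.Exact f g →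
      IsPControlled p P) ∧
    (∀ f : M →+ N,
      IsPControlled p f.ker ∧ IsPControlled p (N ⧸ f.range)) := by
  have hp : 0 < p := (Fact.out : p.Prime).pos
  obtain ⟨a, hMt, hMd⟩ := (isPControlled_iff hp).1 hM
  obtain ⟨b, hNt, hNd⟩ := (isPControlled_iff hp).1 hN
  refine ⟨fun P _ f g hf hg hfg => ?_, fun f => ⟨?_, ?_⟩⟩
  · refine (isPControlled_iff hp).2 ⟨a + b, fun n hn x hx => ?_, fun n hn x => ?_⟩
    · obtain ⟨m, hm⟩ := (hfg (p ^ b • x)).1 (by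
        rw [map_nsmul]; exact hNt n hn _ (by rw [← map_nsmul, hx, map_zero]))
      have hnm : n • m = 0 := hf (by rw [map_nsmul, hm, smul_comm, hx, smul_zero, map_zero])
      rw [pow_add, mul_smul, ← hm, ← map_nsmul, hMt n hn m hnm, map_zero]
    · obtain ⟨z, hz⟩ := hNd n hn (g x)
      obtain ⟨y, rfl⟩ := hg z
      obtain ⟨m, hm⟩ := (hfg (p ^ b • x - n • y)).1 (by
        rw [map_sub, map_nsmul, map_nsmul, hz, sub_self])
      obtain ⟨m', hm'⟩ := hMd n hn m
      refine ⟨p ^ a • y + f m', ?_⟩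
      rw [smul_add, ← map_nsmul, hm', map_nsmul, hm, smul_sub, smul_comm n, pow_add, mul_smul]
      abel
  · refine (isPControlled_iff hp).2 ⟨b + a, fun n hn x hx => ?_, fun n hn x => ?_⟩
    · have hx' : n • (x : M) = 0 := congrArg Subtype.val hx
      ext
      change p ^ (b + a) • (x : M) = 0
      rw [pow_add, mul_smul, hMt n hn _ hx', smul_zero]
    · obtain ⟨y, hy⟩ := hMd n hn x
      have hfy : n • f y = 0 := by
        rw [← map_nsmul, hy, map_nsmul, f.mem_ker.1 x.2, smul_zero]
      refine ⟨⟨p ^ b • y, f.mem_ker.2 (by rw [map_nsmul, hNt n hn _ hfy])⟩, ?_⟩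
      ext
      change n • p ^ b • y = p ^ (b + a) • (x : M)
      rw [smul_comm, hy, pow_add, mul_smul]
  · refine (isPControlled_iff hp).2 ⟨b + a, fun n hn x hx => ?_, fun n hn x => ?_⟩
    · obtain ⟨y, rfl⟩ := QuotientAddGroup.mk_surjective x
      obtain ⟨m, hm⟩ := (QuotientAddGroup.eq_zero_iff (n • y)).1 hx
      obtain ⟨m', hm'⟩ := hMd n hn m
      have h := hNt n hn (p ^ a • y - f m') (by
        rw [smul_sub, ← map_nsmul, hm', map_nsmul, hm, smul_comm, sub_self])
      refine (QuotientAddGroup.eq_zero_iff (p ^ (b + a) • y)).2 ⟨p ^ b • m', ?_⟩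
      rw [smul_sub, sub_eq_zero] at h
      rw [map_nsmul, ← h, pow_add, mul_smul]
    · obtain ⟨y, rfl⟩ := QuotientAddGroup.mk_surjective x
      obtain ⟨z, hz⟩ := hNd n hn (p ^ a • y)
      refine ⟨(z : N ⧸ f.range), ?_⟩
      rw [← QuotientAddGroup.mk_nsmul, hz, ← mul_smul, ← pow_add, QuotientAddGroup.mk_nsmul]
end

section
/- Let k be a perfect field of characteristic p with Frobenius automorphism φ(x) = x^p. The ring homomorphisms W_n(φ^n): W_n(k) → W_n(k), induced by functoriality from the n-th power of φ, define an isomorphism from the limit lim_{n,F} W_n(k) of the tower of Witt vector Frobenius maps F: W_n(k) → W_{n-1}(k) to the limit lim_{n,R} W_n(k) of the tower of restriction maps R: W_n(k) → W_{n-1}(k), the latter limit being the ring W(k) of p-typical Witt vectors. In particular, lim_{n,F} W_n(k) ≅ W(k) as rings. -/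
/-- The limit `lim_{n,F} Wₙ(k)` of the tower of truncated Witt vectors along (descended)
Frobenius maps `F : Wₙ₊₁(k) → Wₙ(k)`, as a subring of the product `∏ₙ Wₙ(k)`. -/
noncomputable def wittFrobeniusLimit (p : ℕ) [Fact p.Prime] (k : Type) [CommRing k]
    (F : ∀ n : ℕ, TruncatedWittVector p (n + 1) k →+* TruncatedWittVector p n k) :
    Subring (∀ n : ℕ, TruncatedWittVector p n k) where
  carrier := {a | ∀ n : ℕ, F n (a (n + 1)) = a n}
  zero_mem' := by intro n; simp
  one_mem' := by intro n; simp
  add_mem' := by intro a b ha hb n; simp [Pi.add_apply, map_add, ha n, hb n]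
  mul_mem' := by intro a b ha hb n; simp [Pi.mul_apply, map_mul, ha n, hb n]
  neg_mem' := by intro a ha n; simp [Pi.neg_apply, map_neg, ha n]

/-- In characteristic `p`, a descent of the Witt vector Frobenius raises coefficients to the `p`-th
power. -/
theorem TruncatedWittVector.coeff_of_comp_truncate_eq_frobenius
    {p : ℕ} [Fact p.Prime] {k : Type*} [CommRing k] [CharP k p] {n : ℕ}
    {F : TruncatedWittVector p (n + 1) k →+* TruncatedWittVector p n k}
    (hF : F.comp (WittVector.truncate (n + 1)) = (WittVector.truncate n).comp WittVector.frobenius)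
    (x : TruncatedWittVector p (n + 1) k) (i : Fin n) :
    (F x).coeff i = x.coeff i.castSucc ^ p := by
  obtain ⟨y, rfl⟩ := WittVector.truncate_surjective p (n + 1) k x
  have h := RingHom.congr_fun hF y
  simp only [RingHom.comp_apply] at h
  rw [h, WittVector.coeff_truncate, WittVector.coeff_truncate, WittVector.coeff_frobenius_charP,
    Fin.val_castSucc]

/-- A descent of the Witt vector map induced by a ring homomorphism `f` applies `f` to
coefficients. -/
theorem TruncatedWittVector.coeff_of_comp_truncate_eq_map
    {p : ℕ} [Fact p.Prime] {R S : Type*} [CommRing R] [CommRing S] {n : ℕ} {f : R →+* S}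
    {g : TruncatedWittVector p n R →+* TruncatedWittVector p n S}
    (hg : g.comp (WittVector.truncate n) = (WittVector.truncate n).comp (WittVector.map f))
    (x : TruncatedWittVector p n R) (i : Fin n) :
    (g x).coeff i = f (x.coeff i) := by
  obtain ⟨y, rfl⟩ := WittVector.truncate_surjective p n R x
  have h := RingHom.congr_fun hg y
  simp only [RingHom.comp_apply] at h
  rw [h, WittVector.coeff_truncate, WittVector.coeff_truncate, WittVector.map_coeff]

/-- Along the Frobenius tower, the `pⁿ`-th powers of the coefficients of the `n`-th component do not
depend on `n`. -/
theorem wittFrobeniusLimit_coeff_pow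
    {p : ℕ} [Fact p.Prime] {k : Type} [CommRing k] [CharP k p]
    {F : ∀ n : ℕ, TruncatedWittVector p (n + 1) k →+* TruncatedWittVector p n k}
    (hF : ∀ n : ℕ, (F n).comp (WittVector.truncate (n + 1)) =
      (WittVector.truncate n).comp WittVector.frobenius)
    (a : wittFrobeniusLimit p k F) {n m : ℕ} (h : n ≤ m) (i : Fin n) :
    (a.1 m).coeff (Fin.castLE h i) ^ p ^ m = (a.1 n).coeff i ^ p ^ n := by
  induction m, h using Nat.le_induction with
  | base => rfl
  | succ m h ih =>
    rw [← ih, ← a.2 m, TruncatedWittVector.coeff_of_comp_truncate_eq_frobenius (hF m), ← pow_mul,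
      ← pow_succ']
    rfl

/-- Let `k` be a perfect field of characteristic `p` with Frobenius
automorphism `φ(x) = x^p`.  The ring homomorphisms `Wₙ(φⁿ) : Wₙ(k) → Wₙ(k)` define a ring
isomorphism from the limit `lim_{n,F} Wₙ(k)` along the Witt vector Frobenius maps to the limit
`lim_{n,R} Wₙ(k)` along the restriction maps, the latter being the ring `W(k)` of `p`-typical
Witt vectors (whose projections are the truncation maps).  In particular
`lim_{n,F} Wₙ(k) ≅ W(k)` as rings. -/
theorem wittFrobeniusLimit_equiv_wittVector
    (p : ℕ) [Fact p.Prime]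
    (k : Type) [Field k] [CharP k p] [ExpChar k p] [PerfectRing k p]
    (F : ∀ n : ℕ, TruncatedWittVector p (n + 1) k →+* TruncatedWittVector p n k)
    (hF : ∀ n : ℕ, (F n).comp (WittVector.truncate (n + 1)) =
      (WittVector.truncate n).comp WittVector.frobenius)
    (φn : ∀ n : ℕ, TruncatedWittVector p n k →+* TruncatedWittVector p n k)
    (hφn : ∀ n : ℕ, (φn n).comp (WittVector.truncate n) =
      (WittVector.truncate n).comp (WittVector.map (iterateFrobenius k p n))) :
    ∃ e : wittFrobeniusLimit p k F ≃+* WittVector p k,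
      ∀ (a : wittFrobeniusLimit p k F) (n : ℕ),
        WittVector.truncate n (e a) = φn n (a.1 n) := by
  have coeff_φn (n : ℕ) (x : TruncatedWittVector p n k) (i : Fin n) :
      (φn n x).coeff i = iterateFrobenius k p n (x.coeff i) :=
    TruncatedWittVector.coeff_of_comp_truncate_eq_map (hφn n) x i
  let f (n : ℕ) : wittFrobeniusLimit p k F →+* TruncatedWittVector p n k :=
    (φn n).comp ((Pi.evalRingHom _ n).comp (wittFrobeniusLimit p k F).subtype)
  have hf (n m : ℕ) (h : n ≤ m) : (TruncatedWittVector.truncate h).comp (f m) = f n := by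
    refine RingHom.ext fun a => TruncatedWittVector.ext fun i => ?_
    rw [RingHom.comp_apply, TruncatedWittVector.coeff_truncate]
    change (φn m (a.1 m)).coeff _ = (φn n (a.1 n)).coeff i
    rw [coeff_φn, coeff_φn, iterateFrobenius_def, iterateFrobenius_def]
    exact wittFrobeniusLimit_coeff_pow hF a h i
  have truncate_lift (a : wittFrobeniusLimit p k F) (n : ℕ) :
      WittVector.truncate n (WittVector.lift f hf a) = φn n (a.1 n) :=
    WittVector.truncate_lift n hf a
  refine ⟨RingEquiv.ofBijective (WittVector.lift f hf) ⟨fun a b hab => ?_, fun w => ?_⟩,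
    truncate_lift⟩
  · refine Subtype.ext (funext fun n => TruncatedWittVector.ext fun i => ?_)
    apply (bijective_iterateFrobenius k p n).injective
    rw [← coeff_φn, ← coeff_φn, ← truncate_lift, ← truncate_lift, hab]
  · let a (n : ℕ) : TruncatedWittVector p n k :=
      TruncatedWittVector.mk p fun i => (iterateFrobeniusEquiv k p n).symm (w.coeff i)
    have ha : a ∈ wittFrobeniusLimit p k F := fun n => TruncatedWittVector.ext fun i => by
      rw [TruncatedWittVector.coeff_of_comp_truncate_eq_frobenius (hF n),
        TruncatedWittVector.coeff_mk, TruncatedWittVector.coeff_mk, RingEquiv.eq_symm_apply,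
        iterateFrobeniusEquiv_def, ← pow_mul, ← pow_succ', ← iterateFrobeniusEquiv_def,
        RingEquiv.apply_symm_apply, Fin.val_castSucc]
    refine ⟨⟨a, ha⟩, WittVector.ext fun i => ?_⟩
    have h : WittVector.truncate (i + 1) (WittVector.lift f hf ⟨a, ha⟩) =
        WittVector.truncate (i + 1) w := by
      refine (truncate_lift _ _).trans (TruncatedWittVector.ext fun j => ?_)
      rw [coeff_φn, TruncatedWittVector.coeff_mk, WittVector.coeff_truncate]
      exact (iterateFrobeniusEquiv k p (i + 1)).apply_symm_apply _
    simpa only [WittVector.coeff_truncate, Fin.val_last] using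
      congrArg (TruncatedWittVector.coeff (Fin.last i)) h
end

section
/- Let (f: S → T, ρ: G → Aut_S(T)) be a Galois extension of commutative rings with finite group G, and let M be an S-module. Then G acts on M ⊗_S T through its action on T, the canonical map M → H^0(G, M ⊗_S T) = (M ⊗_S T)^G induced by m ↦ m ⊗ 1 is an isomorphism, and the group cohomology H^i(G, M ⊗_S T) vanishes for all i > 0. -/
open scoped TensorProduct

/-- A *Galois extension of commutative rings* is a faithfully flat étale ring map `S → T`
together with an action of a finite group `G` on `T` by `S`-algebra automorphisms such that
the map `h : T ⊗_S T → ∏_{g∈G} T`, `h(t₁ ⊗ t₂) = (g(t₁)·t₂)_{g∈G}`, is an isomorphism. -/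
def IsGaloisRingExtension (G : Type) [Group G] (S T : Type) [CommRing S] [CommRing T]
    [Algebra S T] (ρ : G →* (T ≃ₐ[S] T)) : Prop :=
  Algebra.Etale S T ∧ Module.FaithfullyFlat S T ∧
  ∃ h : T ⊗[S] T →+* (G → T),
    (∀ (t₁ t₂ : T) (g : G), h (t₁ ⊗ₜ[S] t₂) g = ρ g t₁ * t₂) ∧ Function.Bijective h

section PartialProd

variable {G : Type*}

lemma Fin.partialProd_contractNth_last [Monoid G] {n : ℕ} (g : Fin (n + 2) → G)
    (j : Fin (n + 1)) :
    Fin.partialProd (Fin.contractNth j.castSucc (· * ·) g) (Fin.last (n + 1)) =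
      Fin.partialProd g (Fin.last (n + 2)) := by
  rw [Fin.partialProd_contractNth, Function.comp_apply, ← Fin.castSucc_succ,
    Fin.succAbove_castSucc_of_le _ _ (Fin.le_last _), Fin.succ_last]

lemma Fin.contractNth_castSucc_snoc {α : Type*} (op : α → α → α) {n : ℕ} (g : Fin (n + 1) → α)
    (h : α) (j : Fin (n + 1)) (hj : j ≠ Fin.last n) :
    Fin.contractNth j.castSucc op (Fin.snoc g h : Fin (n + 2) → α) =
      (Fin.snoc (Fin.contractNth j op g) h : Fin (n + 1) → α) := by
  have hj' : (j : ℕ) < n := Fin.val_lt_last hj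
  funext k
  induction k using Fin.lastCases with
  | last =>
    rw [Fin.contractNth_apply_of_gt _ _ _ _ (by simpa using hj'), Fin.succ_last]
    simp
  | cast k =>
    rw [Fin.snoc_castSucc]
    rcases lt_trichotomy (k : ℕ) j with hk | hk | hk
    · rw [Fin.contractNth_apply_of_lt _ _ _ _ (by simpa using hk),
        Fin.contractNth_apply_of_lt _ _ _ _ hk, Fin.snoc_castSucc]
    · rw [Fin.contractNth_apply_of_eq _ _ _ _ (by simpa using hk),
        Fin.contractNth_apply_of_eq _ _ _ _ hk, Fin.snoc_castSucc, Fin.succ_castSucc,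
        Fin.snoc_castSucc]
    · rw [Fin.contractNth_apply_of_gt _ _ _ _ (by simpa using hk),
        Fin.contractNth_apply_of_gt _ _ _ _ hk, Fin.succ_castSucc, Fin.snoc_castSucc]

lemma Fin.contractNth_last_snoc {α : Type*} (op : α → α → α) {n : ℕ} (g : Fin (n + 1) → α)
    (h : α) :
    Fin.contractNth (Fin.last n).castSucc op (Fin.snoc g h : Fin (n + 2) → α) =
      (Fin.snoc (Fin.contractNth (Fin.last n) op g) (op (g (Fin.last n)) h) :
        Fin (n + 1) → α) := by
  funext k
  induction k using Fin.lastCases with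
  | last =>
    rw [Fin.contractNth_apply_of_eq _ _ _ _ (by simp), Fin.succ_last]
    simp
  | cast k =>
    rw [Fin.snoc_castSucc, Fin.contractNth_apply_of_lt _ _ _ _ (by simp),
      Fin.contractNth_apply_of_lt _ _ _ _ (by simp), Fin.snoc_castSucc]

lemma Fin.sum_contractNth_castSucc_snoc [Group G] [Fintype G] {A : Type*} [AddCommMonoid A]
    {n : ℕ} (F : (Fin (n + 1) → G) → A) (g : Fin (n + 1) → G) (j : Fin (n + 1)) :
    ∑ h : G, F (Fin.contractNth j.castSucc (· * ·) (Fin.snoc g h : Fin (n + 2) → G)) =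
      ∑ h : G, F (Fin.snoc (Fin.contractNth j (· * ·) g) h : Fin (n + 1) → G) := by
  by_cases hj : j = Fin.last n
  · subst hj
    simp only [Fin.contractNth_last_snoc]
    exact Fintype.sum_equiv (Equiv.mulLeft (g (Fin.last n))) _ _ fun _ => rfl
  · simp only [Fin.contractNth_castSucc_snoc _ _ _ _ hj]

end PartialProd

namespace groupCohomology

variable {k G : Type} [CommRing k] [Group G] [Fintype G]

/-- If the identity of a representation `A` is the norm of a linear endomorphism `u`, this is a
contracting homotopy, up to sign, of the complex of inhomogeneous cochains in positive degrees. -/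
noncomputable def normHomotopy (A : Rep k G) (u : A →ₗ[k] A) {n : ℕ} (f : (Fin (n + 1) → G) → A)
    (g : Fin n → G) : A :=
  ∑ h : G,
    let q : Fin (n + 1) → G := Fin.snoc g h
    A.ρ (Fin.partialProd q (Fin.last _)) (u (A.ρ (Fin.partialProd q (Fin.last _))⁻¹ (f q)))

lemma normHomotopy_d (A : Rep k G) (u : A →ₗ[k] A) (hu : ∀ a, ∑ g, A.ρ g (u (A.ρ g⁻¹ a)) = a)
    {n : ℕ} (f : (Fin (n + 1) → G) → A) (g : Fin (n + 1) → G) :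
    normHomotopy A u (inhomogeneousCochains.d A (n + 1) f) g =
      inhomogeneousCochains.d A n (normHomotopy A u f) g + (-1 : k) ^ (n + 2) • f g := by
  have hlast : ∀ h, Fin.contractNth (Fin.last (n + 1)) (· * ·) (Fin.snoc g h : Fin (n + 2) → G) =
      g := fun h => by
    funext i
    rw [Fin.contractNth_apply_of_lt _ _ _ _ i.isLt, Fin.snoc_castSucc]
  have htail : ∀ h, (fun i : Fin (n + 1) => (Fin.snoc g h : Fin (n + 2) → G) i.succ) =
      (Fin.snoc (fun i : Fin n => g i.succ) h : Fin (n + 1) → G) := fun h => by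
    funext i
    induction i using Fin.lastCases with
    | last => rw [Fin.succ_last]; simp
    | cast i => rw [Fin.succ_castSucc, Fin.snoc_castSucc, Fin.snoc_castSucc]
  have hzero : ∀ h, (Fin.snoc g h : Fin (n + 2) → G) 0 = g 0 := fun h =>
    Fin.snoc_castSucc (α := fun _ => G) h g 0
  simp only [normHomotopy, inhomogeneousCochains.d_hom_apply, map_add, map_sum,
    Finset.sum_add_distrib, map_smul, Finset.smul_sum]
  refine Eq.trans ?_ (add_assoc _ _ _).symm
  congr 1
  · refine Finset.sum_congr rfl fun h _ => ?_
    have hp : Fin.partialProd (Fin.snoc g h : Fin (n + 2) → G) (Fin.last (n + 2)) =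
        g 0 * Fin.partialProd (Fin.snoc (fun i : Fin n => g i.succ) h : Fin (n + 1) → G)
          (Fin.last (n + 1)) := by
      rw [← Fin.succ_last, Fin.partialProd_succ', hzero, ← htail]
      rfl
    rw [htail, hzero, hp]
    simp [mul_inv_rev, map_mul, Module.End.mul_apply]
  · rw [Finset.sum_comm, Fin.sum_univ_castSucc]
    congr 1
    · refine Finset.sum_congr rfl fun j _ => ?_
      rw [← Fin.sum_contractNth_castSucc_snoc (fun q => (-1 : k) ^ ((j : ℕ) + 1) •
        A.ρ (Fin.partialProd q (Fin.last _)) (u (A.ρ (Fin.partialProd q (Fin.last _))⁻¹ (f q))))]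
      simp only [Fin.partialProd_contractNth_last, Fin.val_castSucc]
    · simp only [hlast, Fin.val_last, ← Finset.smul_sum]
      congr 1
      conv_rhs => rw [← hu (f g)]
      refine Fintype.sum_equiv (Equiv.mulLeft (Fin.partialProd g (Fin.last _))) _ _ fun h => ?_
      have hp : Fin.partialProd (Fin.snoc g h : Fin (n + 2) → G) (Fin.last (n + 2)) =
          Fin.partialProd g (Fin.last _) * h := by
        rw [← Fin.succ_last, Fin.partialProd_succ, ← Fin.partialProd_init, Fin.init_snoc,
          Fin.snoc_last]
      rw [hp]
      rfl

/-- Positive degree cohomology vanishes if the identity is the norm of an endomorphism. -/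
theorem subsingleton_of_norm_eq_id (A : Rep k G) (u : A →ₗ[k] A)
    (hu : ∀ a, ∑ g, A.ρ g (u (A.ρ g⁻¹ a)) = a) (n : ℕ) :
    Subsingleton (groupCohomology A (n + 1)) := by
  suffices h : (inhomogeneousCochains A).ExactAt (n + 1) from
    ModuleCat.subsingleton_of_isZero h.isZero_homology
  rw [HomologicalComplex.exactAt_iff' _ n (n + 1) (n + 2) (by simp) (by simp),
    CategoryTheory.ShortComplex.moduleCat_exact_iff]
  intro f hf
  replace hf : inhomogeneousCochains.d A (n + 1) f = 0 := by
    rw [← inhomogeneousCochains.d_def]; exact hf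
  refine ⟨(-1 : k) ^ (n + 1) • (normHomotopy A u f : (Fin n → G) → A), ?_⟩
  suffices h : inhomogeneousCochains.d A n
      ((-1 : k) ^ (n + 1) • (normHomotopy A u f : (Fin n → G) → A)) = f by
    rw [← inhomogeneousCochains.d_def] at h; exact h
  funext g
  have key := normHomotopy_d A u hu f g
  rw [hf] at key
  have h0 : normHomotopy A u (0 : (Fin (n + 2) → G) → A) g = 0 := by simp [normHomotopy]
  have key' : inhomogeneousCochains.d A n (normHomotopy A u f) g = (-1 : k) ^ (n + 1) • f g := by
    rw [eq_neg_of_add_eq_zero_left (key.symm.trans h0), ← neg_smul]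
    congr 1
    ring
  rw [map_smul, Pi.smul_apply, key', smul_smul, ← mul_pow]
  simp

end groupCohomology

namespace IsGaloisRingExtension

variable {G : Type} [Group G] {S T : Type} [CommRing S] [CommRing T] [Algebra S T]
  {ρ : G →* (T ≃ₐ[S] T)}

lemma mem_range_algebraMap (hGal : IsGaloisRingExtension G S T ρ) {x : T}
    (hx : ∀ g, ρ g x = x) : x ∈ Set.range (algebraMap S T) := by
  obtain ⟨-, hff, h, hh, hbij⟩ := hGal
  have hcomm : (x ⊗ₜ[S] (1 : T)) = 1 ⊗ₜ[S] x := hbij.1 <| by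
    funext g
    simp [hh, hx]
  let N : Submodule S T := LinearMap.range (Algebra.linearMap S T)
  have h0 : (1 : T) ⊗ₜ[S] N.mkQ x = 0 := by
    have := congrArg (LinearMap.lTensor T N.mkQ) hcomm
    rw [LinearMap.lTensor_tmul, LinearMap.lTensor_tmul] at this
    have h1 : N.mkQ 1 = 0 := by
      rw [Submodule.mkQ_apply, Submodule.Quotient.mk_eq_zero]
      exact ⟨1, by simp⟩
    rw [← this, h1, TensorProduct.tmul_zero]
  have hxN : N.mkQ x = 0 :=
    Module.FaithfullyFlat.tensorProduct_mk_injective (A := S) (B := T) (T ⧸ N)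
      (by simpa using h0)
  rw [Submodule.mkQ_apply, Submodule.Quotient.mk_eq_zero] at hxN
  exact hxN

lemma exists_algebraMap_eq_sum [Fintype G] (hGal : IsGaloisRingExtension G S T ρ) (t : T) :
    ∃ s : S, algebraMap S T s = ∑ g, ρ g t := by
  refine hGal.mem_range_algebraMap fun g => ?_
  rw [map_sum]
  exact Fintype.sum_equiv (Equiv.mulLeft g) _ _ fun _ => by simp [map_mul]

lemma exists_sum_eq_one [Fintype G] (hGal : IsGaloisRingExtension G S T ρ) :
    ∃ t : T, ∑ g, ρ g t = 1 := by
  classical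
  have htr := hGal.exists_algebraMap_eq_sum
  obtain ⟨-, hff, h, hh, hbij⟩ := hGal
  let tr : T →ₗ[S] T := ∑ g, (ρ g).toLinearMap
  have htr_apply : ∀ t, tr t = ∑ g, ρ g t := fun t => by simp [tr]
  let I : Ideal S := (LinearMap.range tr).comap (Algebra.linearMap S T)
  have hsum : ∀ z : T ⊗[S] T, ∑ g, h z g ∈ I.map (algebraMap S T) := fun z => by
    induction z using TensorProduct.induction_on with
    | zero => simp
    | add y z hy hz => simpa [Finset.sum_add_distrib] using add_mem hy hz
    | tmul a b =>
      obtain ⟨s, hs⟩ := htr a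
      simp only [hh, ← Finset.sum_mul, ← hs]
      refine Ideal.mul_mem_right _ _ (Ideal.mem_map_of_mem _ ⟨a, ?_⟩)
      rw [htr_apply, ← hs, Algebra.linearMap_apply]
  obtain ⟨z, hz⟩ := hbij.2 (Pi.single 1 1)
  have htop : I.map (algebraMap S T) = ⊤ := by
    rw [Ideal.eq_top_iff_one]
    simpa [hz] using hsum z
  have hI : (1 : S) ∈ I := by
    rw [← Ideal.comap_map_eq_self_of_faithfullyFlat (B := T) I, htop]
    trivial
  obtain ⟨t, ht⟩ := hI
  exact ⟨t, by rw [← htr_apply, ht]; simp⟩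

end IsGaloisRingExtension

/-- Let `(f : S → T, ρ : G → Aut_S(T))` be a Galois extension of commutative
rings with finite group `G` and let `M` be an `S`-module.  Then `G` acts on `M ⊗_S T` through
its action on `T`, the canonical map `M → H⁰(G, M ⊗_S T) = (M ⊗_S T)^G`, `m ↦ m ⊗ 1`, is an
isomorphism, and the group cohomology `Hⁱ(G, M ⊗_S T)` vanishes for all `i > 0`. -/
theorem galois_descent_for_modules
    (G : Type) [Group G] [Finite G]
    (S T : Type) [CommRing S] [CommRing T] [Algebra S T]
    (ρ : G →* (T ≃ₐ[S] T))
    (hGal : IsGaloisRingExtension G S T ρ)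
    (M : Type) [AddCommGroup M] [Module S M]
    (σ : Representation ℤ G (M ⊗[S] T))
    (hσ : ∀ (g : G) (m : M) (t : T), σ g (m ⊗ₜ[S] t) = m ⊗ₜ[S] (ρ g t)) :
    Function.Injective (fun m : M => (m ⊗ₜ[S] (1 : T) : M ⊗[S] T)) ∧
    (∀ x : M ⊗[S] T, (∀ g : G, σ g x = x) ↔ ∃ m : M, m ⊗ₜ[S] (1 : T) = x) ∧
    (∀ i : ℕ, 0 < i → Subsingleton (groupCohomology (Rep.of σ) i)) := by
  classical
  have := Fintype.ofFinite G
  have hff : Module.FaithfullyFlat S T := hGal.2.1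
  obtain ⟨t, ht⟩ := hGal.exists_sum_eq_one
  have hu : ∀ a : M ⊗[S] T,
      ∑ g, σ g ((LinearMap.lTensor M (LinearMap.mulLeft S t)) (σ g⁻¹ a)) = a := fun a => by
    induction a using TensorProduct.induction_on with
    | zero => simp
    | add a b ha hb => simp only [map_add, Finset.sum_add_distrib, ha, hb]
    | tmul m x =>
      simp only [hσ, LinearMap.lTensor_tmul, LinearMap.mulLeft_apply, map_mul,
        ← TensorProduct.tmul_sum]
      simp [← Finset.sum_mul, ht]
  refine ⟨?_, fun x => ⟨fun hx => ?_, ?_⟩, fun i hi => ?_⟩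
  · intro m m' h
    refine Module.FaithfullyFlat.tensorProduct_mk_injective (A := S) (B := T) M ?_
    simpa using congrArg (TensorProduct.comm S M T) h
  · have hnorm : ∀ a : M ⊗[S] T, ∃ m : M, m ⊗ₜ[S] (1 : T) = ∑ g, σ g a := fun a => by
      induction a using TensorProduct.induction_on with
      | zero => exact ⟨0, by simp⟩
      | add a b ha hb =>
        obtain ⟨m, hm⟩ := ha
        obtain ⟨n, hn⟩ := hb
        exact ⟨m + n, by simp [TensorProduct.add_tmul, hm, hn, Finset.sum_add_distrib]⟩
      | tmul m y =>
        obtain ⟨s, hs⟩ := hGal.exists_algebraMap_eq_sum y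
        refine ⟨s • m, ?_⟩
        simp only [hσ, ← TensorProduct.tmul_sum, ← hs]
        rw [TensorProduct.smul_tmul, Algebra.algebraMap_eq_smul_one]
    obtain ⟨m, hm⟩ := hnorm (LinearMap.lTensor M (LinearMap.mulLeft S t) x)
    refine ⟨m, hm.trans ?_⟩
    simpa only [hx] using hu x
  · rintro ⟨m, rfl⟩ g
    rw [hσ, map_one]
  · obtain ⟨n, rfl⟩ := Nat.exists_eq_succ_of_ne_zero hi.ne'
    exact groupCohomology.subsingleton_of_norm_eq_id (Rep.of σ)
      (LinearMap.lTensor M (LinearMap.mulLeft S t)).toAddMonoidHom.toIntLinearMap hu n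
end

section
/- Let p be a prime number, n ≥ 1 an integer, and let (f: S → T, ρ: G → Aut_S(T)) be a Galois extension of commutative rings with finite group G. Then the pair (W_n(f): W_n(S) → W_n(T), W_n ∘ ρ: G → Aut_{W_n(S)}(W_n(T))) is again a Galois extension of commutative rings with group G; in particular, the ring homomorphism W_n(T) ⊗_{W_n(S)} W_n(T) → ∏_{g∈G} W_n(T) sending x ⊗ y to (W_n(g)(x)·y)_{g∈G} is an isomorphism. -/
open scoped TensorProduct

section GaloisCriterion

variable {G A B : Type} [Group G] [CommRing A] [CommRing B] [Algebra A B]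

/-- The `B`-algebra map `B ⊗_A B → ∏_{g∈G} B`, `x ⊗ y ↦ (x·g(y))_{g∈G}`. -/
noncomputable def galoisTensorMap (ρ : G →* (B ≃ₐ[A] B)) : B ⊗[A] B →ₐ[B] (G → B) :=
  Algebra.TensorProduct.lift (Algebra.ofId B (G → B))
    (AlgHom.pi fun g => (ρ g : B →ₐ[A] B)) fun _ _ => Commute.all _ _

lemma galoisTensorMap_tmul (ρ : G →* (B ≃ₐ[A] B)) (x y : B) (g : G) :
    galoisTensorMap ρ (x ⊗ₜ[A] y) g = x * ρ g y := by
  simp [galoisTensorMap, Algebra.ofId_apply]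

lemma span_sub_eq_top_of_ne {ρ : G →* (B ≃ₐ[A] B)}
    (hρ : ∀ g : G, g ≠ 1 → Ideal.span (Set.range fun b => b - ρ g b) = ⊤) {g k : G}
    (hgk : g ≠ k) : Ideal.span (Set.range fun b => ρ g b - ρ k b) = ⊤ := by
  have h1 : g⁻¹ * k ≠ 1 := fun h => hgk (inv_mul_eq_one.mp h)
  have h2 := congrArg (Ideal.map (ρ g)) (hρ _ h1)
  rw [Ideal.map_span, Ideal.map_top, ← Set.range_comp] at h2
  rw [← h2]
  congr 2
  ext b
  have h3 : ρ k b = ρ g (ρ (g⁻¹ * k) b) := by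
    rw [← AlgEquiv.mul_apply, ← map_mul, mul_inv_cancel_left]
  rw [h3, Function.comp_apply, map_sub]

lemma galoisTensorMap_surjective [Finite G] {ρ : G →* (B ≃ₐ[A] B)}
    (hρ : ∀ g : G, g ≠ 1 → Ideal.span (Set.range fun b => b - ρ g b) = ⊤) :
    Function.Surjective (galoisTensorMap ρ) := by
  intro b
  let P : G → Ideal (B ⊗[A] B) := fun g =>
    RingHom.ker ((Pi.evalRingHom (fun _ : G => B) g).comp (galoisTensorMap ρ).toRingHom)
  have hP : ∀ g x, x ∈ P g ↔ galoisTensorMap ρ x g = 0 := fun g x => Iff.rfl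
  have hcop : Pairwise fun g k => IsCoprime (P g) (P k) := by
    intro g k hgk
    rw [Ideal.isCoprime_iff_sup_eq, eq_top_iff,
      ← Ideal.map_top (Algebra.TensorProduct.includeLeft : B →ₐ[A] B ⊗[A] B),
      ← span_sub_eq_top_of_ne hρ hgk, Ideal.map_span, Ideal.span_le]
    rintro _ ⟨_, ⟨s, rfl⟩, rfl⟩
    have h1 : (ρ g s ⊗ₜ[A] 1 - 1 ⊗ₜ[A] s : B ⊗[A] B) ∈ P g := by
      simp [hP, galoisTensorMap_tmul]
    have h2 : (ρ k s ⊗ₜ[A] 1 - 1 ⊗ₜ[A] s : B ⊗[A] B) ∈ P k := by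
      simp [hP, galoisTensorMap_tmul]
    have h3 := sub_mem (Submodule.mem_sup_left (T := P k) h1) (Submodule.mem_sup_right (S := P g) h2)
    rw [sub_sub_sub_cancel_right] at h3
    simpa [TensorProduct.sub_tmul] using h3
  obtain ⟨r, hr⟩ := Ideal.exists_forall_sub_mem_ideal hcop fun g => b g ⊗ₜ[A] (1 : B)
  refine ⟨r, funext fun g => sub_eq_zero.mp ?_⟩
  have h := (hP g _).mp (hr g)
  rwa [map_sub, Pi.sub_apply, galoisTensorMap_tmul, map_one, mul_one] at h

lemma exists_linearMap_algebraMap_eq_sum [Fintype G] (ρ : G →* (B ≃ₐ[A] B))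
    (hinj : Function.Injective (algebraMap A B))
    (hinv : ∀ b : B, (∀ g, ρ g b = b) → ∃ a, algebraMap A B a = b) :
    ∃ tr : B →ₗ[A] A, ∀ b, algebraMap A B (tr b) = ∑ g, ρ g b := by
  have hsum : ∀ b : B, ∃ a, algebraMap A B a = ∑ g, ρ g b := fun b => hinv _ fun g => by
    rw [map_sum]
    refine Fintype.sum_equiv (Equiv.mulLeft g) _ _ fun k => ?_
    rw [Equiv.coe_mulLeft, map_mul, AlgEquiv.mul_apply]
  choose tr htr using hsum
  refine ⟨{ toFun := tr, map_add' := fun x y => hinj ?_, map_smul' := fun a x => hinj ?_ }, htr⟩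
  · simp [htr, Finset.sum_add_distrib]
  · simp [htr, Algebra.smul_def, Finset.mul_sum]

/-- If a finite group acts on `B` with ring of invariants `A`, and no nontrivial element fixes
a point of the spectrum of `B` together with its residue field, then `A → B` is Galois. -/
theorem isGaloisRingExtension_of_invariants [Finite G] (ρ : G →* (B ≃ₐ[A] B))
    (hinj : Function.Injective (algebraMap A B))
    (hinv : ∀ b : B, (∀ g, ρ g b = b) → ∃ a, algebraMap A B a = b)
    (hρ : ∀ g : G, g ≠ 1 → Ideal.span (Set.range fun b => b - ρ g b) = ⊤) :
    IsGaloisRingExtension G A B ρ := by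
  classical
  cases nonempty_fintype G
  have hsurj := galoisTensorMap_surjective hρ
  obtain ⟨tr, htr⟩ := exists_linearMap_algebraMap_eq_sum ρ hinj hinv
  obtain ⟨e, he⟩ := hsurj (Pi.single 1 1)
  obtain ⟨k, x, y, rfl⟩ := TensorProduct.exists_sum_tmul_eq e
  have hxy : ∀ g, ∑ i, x i * ρ g (y i) = (Pi.single 1 1 : G → B) g := fun g => by
    rw [← he, map_sum, Finset.sum_apply]
    simp only [galoisTensorMap_tmul]
  have hdual : ∀ u : B, ∑ i, tr (u * y i) • x i = u := fun u => by
    simp only [Algebra.smul_def, htr, map_mul, Finset.sum_mul]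
    rw [Finset.sum_comm]
    have h : ∀ g, ∑ i, ρ g u * ρ g (y i) * x i = ρ g u * (Pi.single 1 1 : G → B) g := fun g => by
      rw [← hxy, Finset.mul_sum]
      exact Finset.sum_congr rfl fun i _ => by ring
    simp [h, Pi.single_apply]
  have hz : ∀ z : B ⊗[A] B,
      z = ∑ i, (∑ g, galoisTensorMap ρ z g * ρ g (y i)) ⊗ₜ[A] x i := fun z => by
    induction z with
    | zero => simp
    | add z w hz hw =>
      conv_lhs => rw [hz, hw]
      simp [add_mul, Finset.sum_add_distrib, TensorProduct.add_tmul]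
    | tmul v u =>
      conv_lhs => rw [← hdual u]
      rw [TensorProduct.tmul_sum]
      refine Finset.sum_congr rfl fun i _ => ?_
      rw [← TensorProduct.smul_tmul, Algebra.smul_def, htr, Finset.sum_mul]
      congr 1
      refine Finset.sum_congr rfl fun g _ => ?_
      rw [galoisTensorMap_tmul, map_mul]
      ring
  have hbij : Function.Bijective (galoisTensorMap ρ) :=
    ⟨fun z w h => by rw [hz z, hz w, h], hsurj⟩
  let i : B →ₗ[A] (Fin k → A) := LinearMap.pi fun j => tr ∘ₗ LinearMap.mulRight A (y j)
  let s : (Fin k → A) →ₗ[A] B := Fintype.linearCombination A x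
  have hsi : s ∘ₗ i = LinearMap.id := LinearMap.ext fun u => by
    simpa [s, i, Fintype.linearCombination_apply] using hdual u
  have : Module.Projective A B := Module.Projective.of_split i s hsi
  have : Module.Finite A B :=
    Module.Finite.of_surjective s fun u => ⟨i u, LinearMap.congr_fun hsi u⟩
  have hff : Module.FaithfullyFlat A B := Module.FaithfullyFlat.of_comap_surjective
    (PrimeSpectrum.comap_surjective_iff_injective_of_finite.mpr hinj)
  have : Algebra.Etale B (B ⊗[A] B) :=
    Algebra.Etale.of_equiv (AlgEquiv.ofBijective (galoisTensorMap ρ) hbij).symm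
  refine ⟨Algebra.Etale.of_etale_tensorProduct_of_faithfullyFlat B, hff,
    (galoisTensorMap ρ).toRingHom.comp (Algebra.TensorProduct.comm A B B).toRingHom,
    fun t₁ t₂ g => ?_, ?_⟩
  · simp [galoisTensorMap_tmul, mul_comm]
  · exact hbij.comp (Algebra.TensorProduct.comm A B B).bijective

lemma IsGaloisRingExtension.exists_algebraMap_eq {ρ : G →* (B ≃ₐ[A] B)}
    (h : IsGaloisRingExtension G A B ρ) (b : B) (hb : ∀ g, ρ g b = b) :
    ∃ a, algebraMap A B a = b := by
  obtain ⟨-, hff, f, hf, hbij⟩ := h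
  have heq : b ⊗ₜ[A] (1 : B) = 1 ⊗ₜ[A] b := hbij.1 (funext fun g => by simp [hf, hb])
  have hmem := (Algebra.IsEffective.of_faithfullyFlat A B).eqLocus_includeLeft_includeRight
  exact hmem.subset heq

lemma IsGaloisRingExtension.span_sub_eq_top {ρ : G →* (B ≃ₐ[A] B)}
    (h : IsGaloisRingExtension G A B ρ) {g : G} (hg : g ≠ 1) :
    Ideal.span (Set.range fun b => b - ρ g b) = ⊤ := by
  classical
  obtain ⟨-, -, f, hf, hbij⟩ := h
  obtain ⟨e, he⟩ := hbij.2 (Pi.single 1 1)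
  have key : ∀ z, f z 1 - f z g ∈ Ideal.span (Set.range fun b => b - ρ g b) := fun z => by
    induction z with
    | zero => simp
    | add z w hz hw =>
      rw [map_add, Pi.add_apply, Pi.add_apply, add_sub_add_comm]
      exact add_mem hz hw
    | tmul u v =>
      rw [hf, hf, map_one, AlgEquiv.one_apply, ← sub_mul]
      exact Ideal.mul_mem_right _ _ (Ideal.subset_span ⟨u, rfl⟩)
  rw [Ideal.eq_top_iff_one]
  simpa [he, hg] using key e

end GaloisCriterion

namespace WittVector

variable {p : ℕ} [Fact p.Prime] {R : Type*} [CommRing R]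

lemma ghostComponent_zero_eq_coeff (x : WittVector p R) : ghostComponent 0 x = x.coeff 0 := by
  simp [ghostComponent_apply, wittPolynomial_zero]

lemma ghostComponent_iterate_verschiebung (x : WittVector p R) (n : ℕ) :
    ghostComponent n (verschiebung^[n] x) = (p : R) ^ n * x.coeff 0 := by
  induction n with
  | zero => simp [ghostComponent_zero_eq_coeff]
  | succ n ih => rw [Function.iterate_succ_apply', ghostComponent_verschiebung, ih]; ring

lemma coeff_zero_iterate_frobenius (x : WittVector p R) (n : ℕ) :
    (frobenius^[n] x).coeff 0 = ghostComponent n x := by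
  rw [← ghostComponent_zero_eq_coeff]
  suffices h : ∀ m, ghostComponent m (frobenius^[n] x) = ghostComponent (m + n) x by
    simpa using h 0
  induction n with
  | zero => simp
  | succ n ih =>
    intro m
    rw [Function.iterate_succ_apply', ghostComponent_frobenius, ih, Nat.add_right_comm,
      Nat.add_assoc]

lemma map_iterate_verschiebung {S : Type*} [CommRing S] (φ : R →+* S) (x : WittVector p R)
    (n : ℕ) : map φ (verschiebung^[n] x) = verschiebung^[n] (map φ x) := by
  induction n with
  | zero => rfl
  | succ n ih => rw [Function.iterate_succ_apply', map_verschiebung, ih,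
      Function.iterate_succ_apply']

lemma iterate_verschiebung_sub (x y : WittVector p R) (n : ℕ) :
    verschiebung^[n] (x - y) = verschiebung^[n] x - verschiebung^[n] y :=
  iterate_map_sub verschiebung n x y

/-- If `t - φ t` generate the unit ideal of `R`, then so do the ghost components of the
elements `x - W(φ) x`. -/
lemma map_ghostComponent_span_sub_eq_top (φ : R →+* R)
    (hφ : Ideal.span (Set.range fun t => t - φ t) = ⊤) (n : ℕ) :
    Ideal.map (ghostComponent n)
      (Ideal.span (Set.range fun x : WittVector p R => x - map φ x)) = ⊤ := by
  by_contra hne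
  obtain ⟨m, hm, hle⟩ := Ideal.exists_le_maximal _ hne
  have hmem : ∀ x : WittVector p R, ghostComponent n (x - map φ x) ∈ m := fun x =>
    hle (Ideal.mem_map_of_mem _ (Ideal.subset_span ⟨x, rfl⟩))
  refine hm.ne_top (top_le_iff.mp (hφ ▸ Ideal.span_le.mpr ?_))
  rintro _ ⟨t, rfl⟩
  by_cases hp : (p : R) ∈ m
  · obtain ⟨r, hr⟩ :=
      exists_add_pow_prime_pow_eq (Fact.out : p.Prime) (t - φ t) (φ t) n
    have h := hmem (teichmuller p t)
    rw [map_teichmuller, map_sub, ghostComponent_teichmuller, ghostComponent_teichmuller] at h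
    rw [sub_add_cancel] at hr
    refine hm.isPrime.mem_of_pow_mem (p ^ n) ?_
    have h' : (t - φ t) ^ p ^ n =
        (t ^ p ^ n - φ t ^ p ^ n) - p * ((t - φ t) * φ t * r) := by
      rw [hr]; ring
    rw [h']
    exact sub_mem h (Ideal.mul_mem_right _ _ hp)
  · have h := hmem (verschiebung^[n] (teichmuller p t))
    rw [map_iterate_verschiebung, map_teichmuller, map_sub, ghostComponent_iterate_verschiebung,
      ghostComponent_iterate_verschiebung, teichmuller_coeff_zero, teichmuller_coeff_zero,
      ← mul_sub] at h
    exact (hm.isPrime.mem_or_mem h).resolve_left fun h => hp (hm.isPrime.mem_of_pow_mem n h)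

lemma exists_iterate_verschiebung_mem {I : Ideal (WittVector p R)} {n : ℕ} {a : R}
    (ha : a ∈ Ideal.map (ghostComponent n) I) (c : R) :
    ∃ v : WittVector p R, verschiebung^[n] v ∈ I ∧ v.coeff 0 = c * a := by
  rw [Ideal.map] at ha
  induction ha using Submodule.span_induction generalizing c with
  | mem a ha =>
    obtain ⟨x, hx, rfl⟩ := ha
    refine ⟨teichmuller p c * frobenius^[n] x, ?_, ?_⟩
    · rw [← iterate_verschiebung_mul_left]
      exact I.mul_mem_left _ hx
    · rw [mul_coeff_zero, teichmuller_coeff_zero, coeff_zero_iterate_frobenius]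
  | zero => exact ⟨0, by simp [iterate_map_zero], by simp⟩
  | add a b _ _ iha ihb =>
    obtain ⟨v, hv, hv0⟩ := iha c
    obtain ⟨w, hw, hw0⟩ := ihb c
    refine ⟨v + w, ?_, by rw [add_coeff_zero, hv0, hw0, mul_add]⟩
    rw [iterate_map_add]
    exact add_mem hv hw
  | smul b a _ ih =>
    obtain ⟨v, hv, hv0⟩ := ih (c * b)
    exact ⟨v, hv, by rw [hv0, smul_eq_mul, mul_assoc]⟩

/-- An ideal of `W(R)` all of whose ghost components are the unit ideal becomes the unit ideal
in the truncated Witt vectors. -/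
lemma map_truncate_eq_top {I : Ideal (WittVector p R)}
    (hI : ∀ n, Ideal.map (ghostComponent n) I = ⊤) (n : ℕ) :
    Ideal.map (truncate n) I = ⊤ := by
  suffices h : ∃ y ∈ I, ∀ i < n, (y - 1).coeff i = 0 by
    obtain ⟨y, hy, hy1⟩ := h
    rw [← mem_ker_truncate, RingHom.mem_ker, map_sub, map_one, sub_eq_zero] at hy1
    rw [Ideal.eq_top_iff_one, ← hy1]
    exact Ideal.mem_map_of_mem _ hy
  induction n with
  | zero => exact ⟨0, I.zero_mem, by simp⟩
  | succ n ih =>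
    obtain ⟨y, hy, hy1⟩ := ih
    have hV := eq_iterate_verschiebung hy1
    set w := (y - 1).shift n
    obtain ⟨v, hv, hv0⟩ :=
      exists_iterate_verschiebung_mem (hI n ▸ Submodule.mem_top : w.coeff 0 ∈ _) 1
    refine ⟨y - verschiebung^[n] v, sub_mem hy hv, fun i hi => ?_⟩
    rw [sub_right_comm, hV, ← iterate_verschiebung_sub]
    rcases Nat.lt_succ_iff_lt_or_eq.mp hi with hi | rfl
    · exact iterate_verschiebung_coeff_eq_zero _ hi
    · have h := iterate_verschiebung_coeff (w - v) i 0
      rw [Nat.zero_add] at h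
      rw [h, ← ghostComponent_zero_eq_coeff, map_sub, ghostComponent_zero_eq_coeff,
        ghostComponent_zero_eq_coeff, hv0, one_mul, sub_self]

end WittVector

/-- Let `p` be a prime, `n ≥ 1`, and let `(f : S → T, ρ)` be a Galois
extension of commutative rings with finite group `G`.  Then the induced pair
`(Wₙ(f) : Wₙ(S) → Wₙ(T), Wₙ ∘ ρ)` is again a Galois extension of commutative rings with group
`G`; in particular the ring homomorphism `Wₙ(T) ⊗_{Wₙ(S)} Wₙ(T) → ∏_{g∈G} Wₙ(T)` sending
`x ⊗ y` to `(Wₙ(g)(x)·y)_{g∈G}` is an isomorphism.  Here the `Wₙ(S)`-algebra structure on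
`Wₙ(T)` and the action of `G` on `Wₙ(T)` are induced by functoriality, which is expressed by
their compatibility with the (surjective) truncation maps from the full Witt vectors. -/
theorem wittVector_galois_extension
    (p : ℕ) [Fact p.Prime] (n : ℕ) (hn : 1 ≤ n)
    (G : Type) [Group G] [Finite G]
    (S T : Type) [CommRing S] [CommRing T] [Algebra S T]
    (ρ : G →* (T ≃ₐ[S] T))
    (hGal : IsGaloisRingExtension G S T ρ)
    [Algebra (TruncatedWittVector p n S) (TruncatedWittVector p n T)]
    (halg : (algebraMap (TruncatedWittVector p n S) (TruncatedWittVector p n T)).comp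
        (WittVector.truncate n) =
      (WittVector.truncate n).comp (WittVector.map (algebraMap S T)))
    (ρW : G →* (TruncatedWittVector p n T ≃ₐ[TruncatedWittVector p n S]
      TruncatedWittVector p n T))
    (hρW : ∀ (g : G) (x : WittVector p T),
      ρW g (WittVector.truncate n x) =
        WittVector.truncate n (WittVector.map (ρ g).toAlgHom.toRingHom x)) :
    IsGaloisRingExtension G (TruncatedWittVector p n S) (TruncatedWittVector p n T) ρW := by
  have halg' : ∀ x : WittVector p S, algebraMap (TruncatedWittVector p n S)
      (TruncatedWittVector p n T) (WittVector.truncate n x) =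
        WittVector.truncate n (WittVector.map (algebraMap S T) x) := RingHom.congr_fun halg
  have : Module.FaithfullyFlat S T := hGal.2.1
  have hST : Function.Injective (algebraMap S T) := FaithfulSMul.algebraMap_injective S T
  refine isGaloisRingExtension_of_invariants ρW ?_ ?_ ?_
  · intro a b hab
    obtain ⟨x, rfl⟩ := WittVector.truncate_surjective p n S a
    obtain ⟨y, rfl⟩ := WittVector.truncate_surjective p n S b
    rw [halg', halg'] at hab
    ext i
    have h := congrArg (TruncatedWittVector.coeff i) hab
    rw [WittVector.coeff_truncate, WittVector.coeff_truncate, WittVector.map_coeff,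
      WittVector.map_coeff] at h
    rw [WittVector.coeff_truncate, WittVector.coeff_truncate, hST h]
  · intro b hb
    obtain ⟨x, rfl⟩ := WittVector.truncate_surjective p n T b
    have hx : ∀ i : ℕ, ∃ s, i < n → algebraMap S T s = x.coeff i := fun i => by
      by_cases hi : i < n
      · obtain ⟨s, hs⟩ := hGal.exists_algebraMap_eq (x.coeff i) fun g => by
          have h := congrArg (TruncatedWittVector.coeff ⟨i, hi⟩) ((hρW g x).symm.trans (hb g))
          rwa [WittVector.coeff_truncate, WittVector.coeff_truncate, WittVector.map_coeff] at h
        exact ⟨s, fun _ => hs⟩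
      · exact ⟨0, fun h => absurd h hi⟩
    choose s hs using hx
    refine ⟨WittVector.truncate n (WittVector.mk p s), ?_⟩
    rw [halg']
    ext i
    rw [WittVector.coeff_truncate, WittVector.coeff_truncate, WittVector.map_coeff,
      WittVector.coeff_mk, hs i i.2]
  · intro g hg
    rw [← top_le_iff, ← WittVector.map_truncate_eq_top
      (WittVector.map_ghostComponent_span_sub_eq_top (p := p) (ρ g).toAlgHom.toRingHom
        (hGal.span_sub_eq_top hg)) n, Ideal.map_span, Ideal.span_le]
    rintro _ ⟨_, ⟨x, rfl⟩, rfl⟩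
    refine Ideal.subset_span ⟨WittVector.truncate n x, ?_⟩
    simp only [hρW, map_sub]
end
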